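/- Define the confidence distribution C(δ | y) = 1 - Γ₂(‖y‖²/σ², δ²/σ²) for δ ≥ 0, where y = (y1, y2) ∈ ℝ². If Y = (Y1, Y2) has independent normal components with means (θ1, θ2), common variance σ², and true distance δ₀ = ‖θ‖ > 0, then the random variable C(δ₀ | Y) is uniformly distributed on [0, 1]. -/

import Mathlib

open MeasureTheory ProbabilityTheory Real Filter Set

/-- Modified Bessel function of the first kind, order 0. -/
noncomputable def besselI0 (z : ℝ) : ℝ :=
  ∑' k : ℕ, (z / 2) ^ (2 * k) / ((Nat.factorial k : ℝ)) ^ 2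

/-- Density of the non-central chi-squared distribution with 2 degrees of
freedom and noncentrality `ν`. -/
noncomputable def ncChi2Pdf (ν t : ℝ) : ℝ :=
  (1 / 2) * Real.exp (-(t + ν) / 2) * besselI0 (Real.sqrt (ν * t))

/-- Cdf `Γ₂ x ν` of the non-central chi-squared distribution with 2 degrees
of freedom and noncentrality `ν`. -/
noncomputable def Gamma2 (x ν : ℝ) : ℝ := ∫ t in (0:ℝ)..x, ncChi2Pdf ν t

lemma aux_prod (k : ℕ) : (∏ i ∈ Finset.range k, (2 * (i:ℝ) + 1) / (2 * i + 2)) / ((2*k).factorial : ℝ)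
    = (1/4)^k / ((k.factorial : ℝ))^2 := by
  induction k with
  | zero => simp
  | succ k ih =>
    rw [Finset.prod_range_succ, show 2*(k+1) = 2*k+1+1 by ring, Nat.factorial_succ, Nat.factorial_succ,
      Nat.factorial_succ]
    have h1 : ((2*k).factorial : ℝ) ≠ 0 := by positivity
    have h2 : ((k).factorial : ℝ) ≠ 0 := by positivity
    have h3 : (2 * (k:ℝ) + 1) ≠ 0 := by positivity
    have h4 : (2 * (k:ℝ) + 2) ≠ 0 := by positivity
    have h5 : ((k:ℝ) + 1) ≠ 0 := by positivity
    push_cast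
    rw [div_eq_iff h1] at ih
    rw [ih]
    rw [show (2 * (k:ℝ) + 1 + 1) = 2 * (k + 1) by ring, show (2 * (k:ℝ) + 2) = 2 * (k + 1) by ring]
    field_simp
    rw [pow_succ]; ring

lemma bessel_eq (z : ℝ) : besselI0 z = (1 / π) * ∫ x in (0:ℝ)..π, Real.cosh (z * sin x) := by
  have H : HasSum (fun n : ℕ => ∫ x in (0:ℝ)..π, (z * sin x) ^ (2*n) / ((2*n).factorial : ℝ))
      (∫ x in (0:ℝ)..π, Real.cosh (z * sin x)) := by
    apply intervalIntegral.hasSum_integral_of_dominated_convergence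
      (fun n _ => z ^ (2*n) / ((2*n).factorial : ℝ))
    · intro n
      exact Continuous.aestronglyMeasurable (by fun_prop)
    · intro n
      refine ae_of_all _ fun x _ => ?_
      rw [Real.norm_eq_abs, abs_of_nonneg (div_nonneg ((even_two_mul n).pow_nonneg _) (by positivity))]
      gcongr ?_ / _
      rw [mul_pow]
      apply mul_le_of_le_one_right ((even_two_mul n).pow_nonneg _)
      rw [pow_mul]
      exact pow_le_one₀ (sq_nonneg _) (sin_sq_le_one x)
    · exact ae_of_all _ fun x _ => (Real.hasSum_cosh z).summable
    · simp
    · exact ae_of_all _ fun x _ => Real.hasSum_cosh _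
  have H2 := H.mul_left (1/π)
  rw [← H2.tsum_eq, besselI0]
  congr 1
  ext k
  simp_rw [mul_pow]
  rw [intervalIntegral.integral_div, intervalIntegral.integral_const_mul, integral_sin_pow_even]
  have := aux_prod k
  have hpi := pi_pos.ne'
  calc (z/2)^(2*k) / (k.factorial:ℝ)^2 = z^(2*k) * ((1/4)^k / (k.factorial:ℝ)^2) := by
        rw [div_pow, pow_mul 2 2 k, one_div, inv_pow]; norm_num; ring
    _ = _ := by rw [← this]; field_simp

lemma bessel_cont : Continuous besselI0 := by
  have : besselI0 = fun z => (1 / π) * ∫ x in (0:ℝ)..π, Real.cosh (z * sin x) := funext bessel_eq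
  rw [this]
  refine continuous_const.mul ?_
  apply intervalIntegral.continuous_parametric_intervalIntegral_of_continuous'
  exact Real.continuous_cosh.comp (by fun_prop)

lemma bessel_pos (z : ℝ) : 0 < besselI0 z := by
  rw [bessel_eq]
  refine mul_pos (by positivity) ?_
  apply intervalIntegral.intervalIntegral_pos_of_pos _ (fun x => Real.cosh_pos _) pi_pos
  exact (Real.continuous_cosh.comp (by fun_prop)).intervalIntegrable _ _

lemma pdf_cont (ν : ℝ) : Continuous (ncChi2Pdf ν) := by
  unfold ncChi2Pdf
  have := bessel_cont
  fun_prop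

lemma pdf_pos (ν t : ℝ) : 0 < ncChi2Pdf ν t := by
  unfold ncChi2Pdf
  have := bessel_pos (√(ν * t))
  positivity

lemma angular (a b : ℝ) : ∫ φ in (-π)..π, rexp (a * cos φ + b * sin φ)
    = 2 * π * besselI0 (√(a^2+b^2)) := by
  set ρ := √(a^2+b^2) with hρ
  obtain ⟨β, h1, h2⟩ : ∃ β, ρ * cos β = b ∧ ρ * sin β = a := by
    refine ⟨Complex.arg ⟨b, a⟩, ?_, ?_⟩
    · have := Complex.norm_mul_cos_arg ⟨b, a⟩
      rw [Complex.norm_def, Complex.normSq_mk] at this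
      rw [hρ, show a^2+b^2 = b*b+a*a by ring]; exact this
    · have := Complex.norm_mul_sin_arg ⟨b, a⟩
      rw [Complex.norm_def, Complex.normSq_mk] at this
      rw [hρ, show a^2+b^2 = b*b+a*a by ring]; exact this
  have e : ∀ φ, rexp (a * cos φ + b * sin φ) = (fun x => rexp (ρ * sin x)) (φ + β) := by
    intro φ
    simp only
    rw [sin_add, ← h1, ← h2]; ring_nf
  have hc : Continuous (fun x => rexp (ρ * sin x)) := by fun_prop
  have hc' : Continuous (fun x => rexp (-(ρ * sin x))) := by fun_prop
  simp_rw [e]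
  rw [intervalIntegral.integral_comp_add_right (fun x => rexp (ρ * sin x))]
  have per : Function.Periodic (fun x => rexp (ρ * sin x)) (2*π) := by
    intro x; simp
  have := per.intervalIntegral_add_eq (-π + β) (-π)
  rw [show -π + β + 2 * π = π + β by ring, show -π + 2 * π = π by ring] at this
  rw [this, ← intervalIntegral.integral_add_adjacent_intervals (hc.intervalIntegrable (-π) 0)
    (hc.intervalIntegrable 0 π), bessel_eq]
  have n := intervalIntegral.integral_comp_neg (a := 0) (b := π) (fun x => rexp (ρ * sin x))
  simp only [neg_zero, sin_neg, mul_neg] at n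
  rw [← n, ← intervalIntegral.integral_add (hc'.intervalIntegrable _ _) (hc.intervalIntegrable _ _)]
  simp_rw [Real.cosh_eq]
  rw [intervalIntegral.integral_div]
  have : ∀ x, rexp (-(ρ * sin x)) + rexp (ρ * sin x) = rexp (ρ * sin x) + rexp (-(ρ * sin x)) :=
    fun x => add_comm _ _
  simp_rw [this]
  have hpi := pi_pos.ne'
  field_simp

lemma radial (a b r : ℝ) (hr : 0 < r) :
    ∫ φ in (-π)..π, r * ((2*π)⁻¹ * rexp (-((r * cos φ - a)^2 + (r * sin φ - b)^2)/2))
     = ncChi2Pdf (a^2+b^2) (r^2) * (2 * r) := by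
  have e : ∀ φ, r * ((2*π)⁻¹ * rexp (-((r * cos φ - a)^2 + (r * sin φ - b)^2)/2))
      = (r * (2*π)⁻¹ * rexp (-(r^2 + (a^2+b^2))/2)) * rexp ((r*a) * cos φ + (r*b) * sin φ) := by
    intro φ
    rw [mul_assoc (r * (2*π)⁻¹), ← Real.exp_add, mul_assoc]
    congr 3
    have := sin_sq_add_cos_sq φ
    linear_combination (-r^2/2) * this
  simp_rw [e]
  rw [intervalIntegral.integral_const_mul, angular, ncChi2Pdf,
    show (r*a)^2+(r*b)^2 = (a^2+b^2)*r^2 by ring]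
  have hpi := pi_pos.ne'
  field_simp

lemma law (a b x : ℝ) (hx : 0 ≤ x) :
    ((gaussianReal a 1).prod (gaussianReal b 1)) {p | p.1^2+p.2^2 < x}
     = ENNReal.ofReal (Gamma2 x (a^2+b^2)) := by
  have hm : MeasurableSet {p : ℝ × ℝ | p.1^2+p.2^2 < x} :=
    measurableSet_lt (by fun_prop) (by fun_prop)
  have hs : Measurable (fun p : ℝ × ℝ => polarCoord.symm p) := by
    simp only [polarCoord_symm_apply]; fun_prop
  have hg : ∀ p : ℝ × ℝ, gaussianPDF a 1 p.1 * gaussianPDF b 1 p.2 =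
      ENNReal.ofReal ((2*π)⁻¹ * rexp (-((p.1 - a)^2 + (p.2 - b)^2)/2)) := by
    intro p
    rw [gaussianPDF, gaussianPDF, ← ENNReal.ofReal_mul (gaussianPDFReal_nonneg _ _ _)]
    congr 1
    simp only [gaussianPDFReal, NNReal.coe_one, mul_one]
    rw [mul_mul_mul_comm, ← Real.exp_add, ← mul_inv, Real.mul_self_sqrt (by positivity)]
    congr 2; ring
  rw [gaussianReal_of_var_ne_zero _ one_ne_zero, gaussianReal_of_var_ne_zero _ one_ne_zero,
    prod_withDensity (measurable_gaussianPDF _ _) (measurable_gaussianPDF _ _),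
    withDensity_apply _ hm, ← lintegral_indicator hm]
  simp_rw [hg]
  rw [← Measure.volume_eq_prod, ← lintegral_comp_polarCoord_symm, polarCoord_target,
    Measure.volume_eq_prod, setLIntegral_prod]
  swap
  · refine Measurable.aemeasurable ?_
    refine Measurable.smul (f := fun p : ℝ × ℝ => ENNReal.ofReal p.1)
      (ENNReal.measurable_ofReal.comp measurable_fst) ?_
    refine Measurable.comp (Measurable.indicator ?_ hm) hs
    fun_prop
  have inner : ∀ r ∈ Ioi (0:ℝ), (∫⁻ φ in Ioo (-π) π, ENNReal.ofReal r •
      ({p : ℝ × ℝ | p.1^2+p.2^2 < x}.indicator (fun p =>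
        ENNReal.ofReal ((2*π)⁻¹ * rexp (-((p.1 - a)^2 + (p.2 - b)^2)/2))) (polarCoord.symm (r, φ))))
      = (Iio (√x)).indicator (fun r => ENNReal.ofReal (ncChi2Pdf (a^2+b^2) (r^2) * (2 * r))) r := by
    intro r hr
    have hr' : 0 < r := hr
    have hmem : ∀ φ, polarCoord.symm (r, φ) ∈ {p : ℝ × ℝ | p.1^2+p.2^2 < x} ↔ r < √x := by
      intro φ
      simp only [polarCoord_symm_apply, mem_ofPred_eq]
      rw [Real.lt_sqrt hr'.le, show (r * cos φ)^2 + (r * sin φ)^2 = r^2 by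
        linear_combination r^2 * sin_sq_add_cos_sq φ]
    by_cases h : r < √x
    · rw [indicator_of_mem (show r ∈ Iio (√x) from h), ← radial a b r hr',
        intervalIntegral.integral_of_le (by linarith [pi_pos]), integral_Ioc_eq_integral_Ioo,
        ofReal_integral_eq_lintegral_ofReal]
      · refine lintegral_congr fun φ => ?_
        rw [indicator_of_mem ((hmem φ).2 h), smul_eq_mul, ← ENNReal.ofReal_mul hr'.le]
        simp only [polarCoord_symm_apply]
      · refine (Continuous.integrableOn_Icc (a := -π) (b := π) ?_).mono_set Ioo_subset_Icc_self
        fun_prop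
      · exact ae_of_all _ fun φ => by simp only [Pi.zero_apply]; positivity
    · rw [indicator_of_notMem (show r ∉ Iio (√x) from h)]
      rw [← lintegral_zero (μ := volume.restrict (Ioo (-π) π))]
      refine lintegral_congr fun φ => ?_
      rw [indicator_of_notMem (fun hh => h ((hmem φ).1 hh)), smul_zero]
  rw [setLIntegral_congr_fun measurableSet_Ioi inner, lintegral_indicator measurableSet_Iio,
    Measure.restrict_restrict measurableSet_Iio, inter_comm, Ioi_inter_Iio]
  have hpc := pdf_cont (a^2+b^2)
  have sub := intervalIntegral.integral_comp_mul_deriv' (a := 0) (b := √x) (f := fun r => r^2)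
    (f' := fun r => 2 * r) (g := ncChi2Pdf (a^2+b^2))
    (fun r _ => by simpa using hasDerivAt_pow 2 r) (by fun_prop) hpc.continuousOn
  simp only [Function.comp] at sub
  rw [Real.sq_sqrt hx, zero_pow two_ne_zero] at sub
  rw [Gamma2, ← sub, intervalIntegral.integral_of_le (Real.sqrt_nonneg _),
    integral_Ioc_eq_integral_Ioo, ofReal_integral_eq_lintegral_ofReal]
  · refine (Continuous.integrableOn_Icc (a := 0) (b := √x) ?_).mono_set Ioo_subset_Icc_self
    fun_prop
  · filter_upwards [ae_restrict_mem measurableSet_Ioo] with r hr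
    have := pdf_pos (a^2+b^2) (r^2)
    have := hr.1
    simp only [Pi.zero_apply]; positivity

lemma Gamma2_strictMono (ν : ℝ) : StrictMono (fun x => Gamma2 x ν) := by
  intro x y hxy
  have hc := pdf_cont ν
  have h := intervalIntegral.integral_add_adjacent_intervals (hc.intervalIntegrable (μ := volume) 0 x)
    (hc.intervalIntegrable x y)
  have := intervalIntegral.intervalIntegral_pos_of_pos (hc.intervalIntegrable x y) (pdf_pos ν) hxy
  simp only [Gamma2]
  linarith

lemma Gamma2_cont (ν : ℝ) : Continuous (fun x => Gamma2 x ν) :=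
  intervalIntegral.continuous_primitive (fun a b => (pdf_cont ν).intervalIntegrable a b) 0

lemma unif {μ : Measure (ℝ × ℝ)} [IsProbabilityMeasure μ] (ν : ℝ)
    (h : ∀ x, 0 ≤ x → μ {p | p.1^2+p.2^2 < x} = ENNReal.ofReal (Gamma2 x ν)) :
    ∀ t ∈ Icc (0:ℝ) 1, μ {p | 1 - Gamma2 (p.1^2+p.2^2) ν ≤ t} = ENNReal.ofReal t := by
  have hsm := Gamma2_strictMono ν
  have hc := Gamma2_cont ν
  have h0 : Gamma2 0 ν = 0 := by simp [Gamma2]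
  have hm : ∀ x, MeasurableSet {p : ℝ × ℝ | p.1^2+p.2^2 < x} :=
    fun x => measurableSet_lt (by fun_prop) (by fun_prop)
  have hlim : Tendsto (fun n : ℕ => ENNReal.ofReal (Gamma2 n ν)) atTop (nhds 1) := by
    have := tendsto_measure_iUnion_atTop (μ := μ) (s := fun n : ℕ => {p : ℝ × ℝ | p.1^2+p.2^2 < n})
      (by
        intro m n hmn p hp
        have : (m:ℝ) ≤ n := by exact_mod_cast hmn
        exact lt_of_lt_of_le hp this)
    have hU : (⋃ n : ℕ, {p : ℝ × ℝ | p.1^2+p.2^2 < n}) = univ := by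
      ext p
      simpa using exists_nat_gt (p.1^2+p.2^2)
    rw [hU, measure_univ] at this
    refine this.congr fun n => ?_
    exact h n (by positivity)
  have key : ∀ t, 0 < t → t ≤ 1 →
      μ {p | 1 - Gamma2 (p.1^2+p.2^2) ν ≤ t} = ENNReal.ofReal t := by
    intro t ht0 ht1
    obtain ⟨n, hn⟩ : ∃ n : ℕ, 1 - t < Gamma2 n ν := by
      have : ENNReal.ofReal (1 - t) < 1 := by
        rw [ENNReal.ofReal_lt_one]; linarith
      obtain ⟨n, hn⟩ := (hlim.eventually (lt_mem_nhds this)).exists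
      exact ⟨n, (ENNReal.ofReal_lt_ofReal_iff_of_nonneg (by linarith)).1 hn⟩
    obtain ⟨x, hx, hxe⟩ := intermediate_value_Icc (a := (0:ℝ)) (b := n) (by positivity)
      hc.continuousOn (show 1 - t ∈ Icc _ _ from ⟨by simp only [h0]; linarith, hn.le⟩)
    simp only at hxe
    have : {p : ℝ × ℝ | 1 - Gamma2 (p.1^2+p.2^2) ν ≤ t} = {p | p.1^2+p.2^2 < x}ᶜ := by
      ext p
      simp only [mem_ofPred_eq, mem_compl_iff, not_lt]
      rw [← hsm.le_iff_le (a := x)]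
      simp only [hxe]
      constructor <;> intro <;> linarith
    rw [this, prob_compl_eq_one_sub (hm x), h x hx.1, hxe, ← ENNReal.ofReal_one,
      ← ENNReal.ofReal_sub _ (by linarith)]
    congr 1; ring
  intro t ⟨ht0, ht1⟩
  rcases ht0.eq_or_lt with rfl | ht
  · rw [ENNReal.ofReal_zero]
    refine le_antisymm ?_ zero_le
    refine ENNReal.le_of_forall_pos_le_add fun ε hε _ => ?_
    have hε' : (0:ℝ) < ε := hε
    calc _ ≤ μ {p | 1 - Gamma2 (p.1^2+p.2^2) ν ≤ min (ε:ℝ) 1} := by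
          refine measure_mono fun p hp => ?_
          exact le_trans (show _ ≤ (0:ℝ) from hp) (by positivity)
      _ = ENNReal.ofReal (min (ε:ℝ) 1) := key _ (by positivity) (min_le_right _ _)
      _ ≤ ENNReal.ofReal ε := ENNReal.ofReal_le_ofReal (min_le_left _ _)
      _ = 0 + ε := by simp
  · exact key t ht ht1


theorem stmt_4 {Ω : Type*} [MeasureSpace Ω] [IsProbabilityMeasure (ℙ : Measure Ω)]
    (θ₁ θ₂ σ : ℝ) (hσ : 0 < σ) (Y₁ Y₂ : Ω → ℝ)
    (h₁ : Measure.map Y₁ ℙ = gaussianReal θ₁ ⟨σ ^ 2, sq_nonneg σ⟩)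
    (h₂ : Measure.map Y₂ ℙ = gaussianReal θ₂ ⟨σ ^ 2, sq_nonneg σ⟩)
    (hind : IndepFun Y₁ Y₂ ℙ)
    (δ₀ : ℝ) (hδ₀ : δ₀ = Real.sqrt (θ₁ ^ 2 + θ₂ ^ 2)) (hδ₀pos : 0 < δ₀) :
    ∀ t ∈ Set.Icc (0:ℝ) 1,
      ℙ {ω | 1 - Gamma2 ((Y₁ ω ^ 2 + Y₂ ω ^ 2) / σ ^ 2) (δ₀ ^ 2 / σ ^ 2) ≤ t}
        = ENNReal.ofReal t := by
  change Measure.map Y₁ ℙ = gaussianReal θ₁ (NNReal.mk (σ^2) (sq_nonneg σ)) at h₁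
  change Measure.map Y₂ ℙ = gaussianReal θ₂ (NNReal.mk (σ^2) (sq_nonneg σ)) at h₂
  have hm₁ : AEMeasurable Y₁ ℙ := aemeasurable_of_map_neZero (by rw [h₁]; infer_instance)
  have hm₂ : AEMeasurable Y₂ ℙ := aemeasurable_of_map_neZero (by rw [h₂]; infer_instance)
  have hvar : NNReal.mk (σ ^ 2) (sq_nonneg σ) / NNReal.mk (σ ^ 2) (sq_nonneg σ) = 1 := by
    apply div_self
    intro h
    have := congrArg NNReal.toReal h
    simp at this
    exact hσ.ne' this
  have l₁ := gaussianReal_div_const (P := ℙ) (X := Y₁) ⟨hm₁, h₁⟩ σ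
  have l₂ := gaussianReal_div_const (P := ℙ) (X := Y₂) ⟨hm₂, h₂⟩ σ
  rw [hvar] at l₁ l₂
  have hi : IndepFun (fun ω => Y₁ ω / σ) (fun ω => Y₂ ω / σ) ℙ :=
    hind.comp (φ := fun x => x / σ) (ψ := fun x => x / σ) (by fun_prop) (by fun_prop)
  have hp := hi.map_prod_eq_prod_map_map l₁.aemeasurable l₂.aemeasurable
  rw [l₁.map_eq, l₂.map_eq] at hp
  have hν : δ₀ ^ 2 / σ ^ 2 = (θ₁ / σ)^2 + (θ₂ / σ)^2 := by
    rw [hδ₀, Real.sq_sqrt (by positivity)]; ring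
  intro t ht
  have := unif _ (law (θ₁ / σ) (θ₂ / σ)) t ht
  rw [← hp, Measure.map_apply_of_aemeasurable (l₁.aemeasurable.prodMk l₂.aemeasurable)] at this
  · rw [← this, hν]
    congr 1
    ext ω
    simp only [mem_ofPred_eq, mem_preimage]
    rw [show (Y₁ ω ^ 2 + Y₂ ω ^ 2) / σ ^ 2 = (Y₁ ω / σ)^2 + (Y₂ ω / σ)^2 by ring]
  · have hc := Gamma2_cont ((θ₁ / σ)^2 + (θ₂ / σ)^2)
    have : Continuous fun p : ℝ × ℝ => 1 - Gamma2 (p.1^2+p.2^2) ((θ₁ / σ)^2 + (θ₂ / σ)^2) :=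
      continuous_const.sub (hc.comp (f := fun p : ℝ × ℝ => p.1^2+p.2^2) (by fun_prop))
    exact measurableSet_le this.measurable measurable_const
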